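/- Let β ∈ ℝ∖ℚ, u, t, s ∈ ℝ, let c ≥ 1 be an integer, l ∈ ℤ∖{0}, and q, r ∈ (1/c)·ℤ. Let p(x) = P(x) + ρ where P is a nonconstant polynomial with integer coefficients and ρ ∈ ℝ, and set a(n) = p(n)/l. Then lim_{N→∞} (1/N)·Σ_{n=1}^N e(q·a(n) + β·r·a(n) − {a(n)}·t + {β·a(n)+u}·s) exists and equals e(−ru) · ((1/|cl|)·Σ_{j=1}^{|cl|} e(q·p(j)/l − {p(j)/l}·t)) · J_r, where J_r = 0 if r ∉ ℤ; J_r = 1 if r ∈ ℤ and r = −s; J_r = 0 if r ∈ ℤ and r + s ∈ ℤ∖{0}; and J_r = (e(r+s) − 1)/(2πi(r+s)) if r ∈ ℤ and r + s ∉ ℤ. In particular the limit is 0 if and only if (1/|cl|)·Σ_{j=1}^{|cl|} e(q·p(j)/l − {p(j)/l}·t) = 0, or r ∉ ℤ, or r + s ∈ ℤ∖{0}. -/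

import Mathlib

open Filter Finset
open scoped Classical

noncomputable section

/-- `e(x) = exp(2πix)`. -/
def e (x : ℝ) : ℂ := Complex.exp (2 * (Real.pi : ℂ) * Complex.I * (x : ℂ))

/-- The factor `J_r` for real `r`: `0` if `r ∉ ℤ`; `1` if `r ∈ ℤ` and `r = −s`; `0` if
`r ∈ ℤ` and `r + s ∈ ℤ∖{0}`; `(e(r+s) − 1)/(2πi(r+s))` if `r ∈ ℤ` and `r + s ∉ ℤ`. -/
def IfacR (r s : ℝ) : ℂ :=
  if ¬ ∃ m : ℤ, (m : ℝ) = r then 0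
  else if r = -s then 1
  else if ∃ m : ℤ, m ≠ 0 ∧ (m : ℝ) = r + s then 0
  else (e (r + s) - 1) / (2 * (Real.pi : ℂ) * Complex.I * ((r + s : ℝ) : ℂ))

theorem e_add (x y : ℝ) : e (x + y) = e x * e y := by
  simp only [e, ← Complex.exp_add]
  push_cast
  ring_nf

theorem e_zero : e 0 = 1 := by simp [e]

theorem norm_e (x : ℝ) : ‖e x‖ = 1 := by
  have : e x = Complex.exp ((2 * Real.pi * x : ℝ) * Complex.I) := by
    simp only [e]
    push_cast
    ring_nf
  rw [this, Complex.norm_exp_ofReal_mul_I]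

theorem conj_e (x : ℝ) : starRingEnd ℂ (e x) = e (-x) := by
  simp [e, ← Complex.exp_conj, Complex.conj_ofNat]

theorem e_eq_one_iff (x : ℝ) : e x = 1 ↔ ∃ m : ℤ, (m : ℝ) = x := by
  rw [e, Complex.exp_eq_one_iff]
  refine exists_congr fun m => ?_
  have h : (2 * (Real.pi : ℂ) * Complex.I) ≠ 0 := Complex.two_pi_I_ne_zero
  rw [mul_comm (m : ℂ), mul_right_inj' h]
  constructor
  · intro h
    exact_mod_cast h.symm
  · rintro rfl
    simp

theorem e_intCast (m : ℤ) : e m = 1 := (e_eq_one_iff _).2 ⟨m, rfl⟩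

theorem e_int_mul_fract (m : ℤ) (x : ℝ) : e (m * Int.fract x) = e (m * x) := by
  have h : (m : ℝ) * x = m * Int.fract x + ((m * ⌊x⌋ : ℤ) : ℝ) := by
    push_cast
    rw [← mul_add, Int.fract_add_floor]
  rw [h, e_add, e_intCast, mul_one]

theorem continuous_e : Continuous e := by
  unfold e
  fun_prop

/-- The averages of the first `N` terms of a sequence. -/
def cesaro (z : ℕ → ℂ) (N : ℕ) : ℂ := (N : ℂ)⁻¹ * ∑ n ∈ range N, z n

theorem cesaro_add (z w : ℕ → ℂ) (N : ℕ) :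
    cesaro (fun n => z n + w n) N = cesaro z N + cesaro w N := by
  simp [cesaro, sum_add_distrib, mul_add]

theorem cesaro_sub (z w : ℕ → ℂ) (N : ℕ) :
    cesaro (fun n => z n - w n) N = cesaro z N - cesaro w N := by
  simp [cesaro, sum_sub_distrib, mul_sub]

theorem cesaro_const_mul (b : ℂ) (z : ℕ → ℂ) (N : ℕ) :
    cesaro (fun n => b * z n) N = b * cesaro z N := by
  simp [cesaro, ← mul_sum, mul_left_comm]

theorem cesaro_sum {ι : Type*} (s : Finset ι) (z : ι → ℕ → ℂ) (N : ℕ) :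
    cesaro (fun n => ∑ i ∈ s, z i n) N = ∑ i ∈ s, cesaro (z i) N := by
  simp only [cesaro]
  rw [sum_comm, mul_sum]

theorem cesaro_ofReal (x : ℕ → ℝ) (N : ℕ) :
    cesaro (fun n => (x n : ℂ)) N = (((N : ℝ)⁻¹ * ∑ n ∈ range N, x n : ℝ) : ℂ) := by
  simp [cesaro]

theorem norm_cesaro_le_re {z : ℕ → ℂ} {w : ℕ → ℝ} (h : ∀ n, ‖z n‖ ≤ w n) (N : ℕ) :
    ‖cesaro z N‖ ≤ (cesaro (fun n => (w n : ℂ)) N).re := by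
  rw [cesaro_ofReal, Complex.ofReal_re, cesaro, norm_mul, norm_inv, Complex.norm_natCast]
  gcongr
  exact norm_sum_le_of_le _ fun n _ => h n

theorem norm_cesaro_le {z : ℕ → ℂ} {B : ℝ} (hB : 0 ≤ B) (h : ∀ n, ‖z n‖ ≤ B) (N : ℕ) :
    ‖cesaro z N‖ ≤ B := by
  refine (norm_cesaro_le_re h N).trans ?_
  rw [cesaro_ofReal, Complex.ofReal_re]
  rcases N.eq_zero_or_pos with rfl | hN
  · simpa
  · have : (N : ℝ) ≠ 0 := by positivity
    simp [this]

theorem tendsto_cesaro_zero_of_bounded {z : ℕ → ℂ} {B : ℝ}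
    (h : ∀ N, ‖∑ n ∈ range N, z n‖ ≤ B) : Tendsto (cesaro z) atTop (nhds 0) := by
  refine squeeze_zero_norm (a := fun N : ℕ => (N : ℝ)⁻¹ * B) (fun N => ?_) ?_
  · rw [cesaro, norm_mul, norm_inv, Complex.norm_natCast]
    gcongr
    exact h N
  · simpa using (tendsto_inv_atTop_nhds_zero_nat (𝕜 := ℝ)).mul_const B

theorem tendsto_cesaro_shift_sub {z : ℕ → ℂ} {B : ℝ} (h : ∀ n, ‖z n‖ ≤ B) (k : ℕ) :
    Tendsto (fun N => cesaro (fun n => z (n + k)) N - cesaro z N) atTop (nhds 0) := by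
  simp only [← cesaro_sub]
  refine tendsto_cesaro_zero_of_bounded (B := k * B + k * B) fun N => ?_
  have h1 := sum_range_add z N k
  have h2 := sum_range_add z k N
  have h3 : ∑ n ∈ range N, (z (n + k) - z n) =
      ∑ n ∈ range k, z (N + n) - ∑ n ∈ range k, z n := by
    rw [sum_sub_distrib]
    rw [add_comm k N, h1] at h2
    simp only [add_comm _ k]
    linear_combination -h2
  have hk : ∀ g : ℕ → ℕ, ‖∑ n ∈ range k, z (g n)‖ ≤ k * B := fun g => by
    simpa using norm_sum_le_of_le (range k) fun n _ => h (g n)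
  rw [h3]
  exact (norm_sub_le _ _).trans (add_le_add (hk _) (hk _))

theorem tendsto_cesaro_shift {z : ℕ → ℂ} {B : ℝ} (h : ∀ n, ‖z n‖ ≤ B) {V : ℂ}
    (hz : Tendsto (cesaro z) atTop (nhds V)) (k : ℕ) :
    Tendsto (cesaro fun n => z (n + k)) atTop (nhds V) := by
  simpa using (tendsto_cesaro_shift_sub h k).add hz

theorem norm_cesaro_sq_le (z : ℕ → ℂ) (N : ℕ) :
    ‖cesaro z N‖ ^ 2 ≤ ‖cesaro (fun n => z n * starRingEnd ℂ (z n)) N‖ := by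
  have h1 : cesaro (fun n => z n * starRingEnd ℂ (z n)) N =
      (((N : ℝ)⁻¹ * ∑ n ∈ range N, ‖z n‖ ^ 2 : ℝ) : ℂ) := by
    rw [← cesaro_ofReal]
    congr 1
    ext n
    simp [Complex.mul_conj']
  rw [h1, Complex.norm_real, Real.norm_of_nonneg (by positivity), cesaro, norm_mul, norm_inv,
    Complex.norm_natCast, mul_pow]
  rcases N.eq_zero_or_pos with rfl | hN
  · simp
  have hN' : (0 : ℝ) < N := by exact_mod_cast hN
  have h2 : ‖∑ n ∈ range N, z n‖ ^ 2 ≤ N * ∑ n ∈ range N, ‖z n‖ ^ 2 := by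
    calc ‖∑ n ∈ range N, z n‖ ^ 2 ≤ (∑ n ∈ range N, ‖z n‖) ^ 2 := by
          gcongr
          exact norm_sum_le _ _
      _ ≤ _ := by simpa using sq_sum_le_card_mul_sum_sq (s := range N) (f := fun n => ‖z n‖)
  calc (N : ℝ)⁻¹ ^ 2 * ‖∑ n ∈ range N, z n‖ ^ 2
      ≤ (N : ℝ)⁻¹ ^ 2 * (N * ∑ n ∈ range N, ‖z n‖ ^ 2) := by gcongr
    _ = _ := by field_simp

/-- Van der Corput's inequality, in its qualitative form. -/
theorem tendsto_cesaro_zero_of_correlations {z : ℕ → ℂ} (hz : ∀ n, ‖z n‖ ≤ 1)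
    (hc : ∀ h : ℕ, 0 < h →
      Tendsto (cesaro fun n => z (n + h) * starRingEnd ℂ (z n)) atTop (nhds 0)) :
    Tendsto (cesaro z) atTop (nhds 0) := by
  have hb : ∀ i j : ℕ, ‖z i * starRingEnd ℂ (z j)‖ ≤ 1 := fun i j => by
    rw [norm_mul, RCLike.norm_conj]
    exact mul_le_one₀ (hz _) (norm_nonneg _) (hz _)
  have hlt : ∀ i j : ℕ, j < i →
      Tendsto (cesaro fun n => z (n + i) * starRingEnd ℂ (z (n + j))) atTop (nhds 0) := by
    intro i j hij
    convert tendsto_cesaro_shift (z := fun n => z (n + (i - j)) * starRingEnd ℂ (z n))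
      (fun n => hb _ _) (hc (i - j) (by omega)) j using 4 with n
    congr 1
    omega
  have hne : ∀ i j : ℕ, i ≠ j →
      Tendsto (cesaro fun n => z (n + i) * starRingEnd ℂ (z (n + j))) atTop (nhds 0) := by
    intro i j hij
    rcases lt_or_gt_of_ne hij with h | h
    · have h1 := (Complex.continuous_conj.tendsto 0).comp (hlt j i h)
      rw [map_zero] at h1
      refine h1.congr fun N => ?_
      simp [cesaro, mul_comm]
    · exact hlt i j h
  rw [Metric.tendsto_atTop']
  intro ε hε
  obtain ⟨H, hH⟩ := exists_nat_gt (max 1 (9 / ε ^ 2))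
  have hH1 : (1 : ℝ) < H := (le_max_left _ _).trans_lt hH
  have hH2 : 9 / ε ^ 2 < H := (le_max_right _ _).trans_lt hH
  set S : ℕ → ℂ := fun n => ∑ i ∈ range H, z (n + i) with hS
  have hsq : ∀ N, cesaro (fun n => S n * starRingEnd ℂ (S n)) N =
      ∑ i ∈ range H, ∑ j ∈ range H,
        cesaro (fun n => z (n + i) * starRingEnd ℂ (z (n + j))) N := by
    intro N
    simp only [hS, map_sum, sum_mul_sum, cesaro_sum]
  have hdiag : Tendsto (fun N => ∑ i ∈ range H, ∑ j ∈ range H,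
      (if i = j then 0 else ‖cesaro (fun n => z (n + i) * starRingEnd ℂ (z (n + j))) N‖))
      atTop (nhds 0) := by
    have h0 : ∀ i j, Tendsto (fun N => if i = j then 0 else
        ‖cesaro (fun n => z (n + i) * starRingEnd ℂ (z (n + j))) N‖) atTop (nhds 0) := by
      intro i j
      split_ifs with hij
      · exact tendsto_const_nhds
      · simpa using (hne i j hij).norm
    simpa using tendsto_finsetSum (range H) fun i _ =>
      tendsto_finsetSum (range H) fun j _ => h0 i j
  have hmean : Tendsto (fun N => cesaro S N - H * cesaro z N) atTop (nhds 0) := by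
    have : (fun N => cesaro S N - H * cesaro z N) =
        fun N => ∑ i ∈ range H, (cesaro (fun n => z (n + i)) N - cesaro z N) := by
      ext N
      simp [hS, cesaro_sum]
    rw [this, show (0 : ℂ) = ∑ i ∈ range H, 0 by simp]
    exact tendsto_finsetSum _ fun i _ => tendsto_cesaro_shift_sub hz i
  have ev1 := hdiag.eventually (gt_mem_nhds (show (0 : ℝ) < H by linarith))
  have ev2 := hmean.norm.eventually (gt_mem_nhds (show ‖(0 : ℂ)‖ < 1 by simp))
  obtain ⟨N0, hN0⟩ := eventually_atTop.1 (ev1.and ev2)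
  refine ⟨N0, fun N hN => ?_⟩
  obtain ⟨h1, h2⟩ := hN0 N hN.le
  rw [dist_zero_right]
  have h3 : ‖cesaro (fun n => S n * starRingEnd ℂ (S n)) N‖ ≤ 2 * H := by
    rw [hsq]
    have : ∀ i ∈ range H, ∀ j ∈ range H,
        ‖cesaro (fun n => z (n + i) * starRingEnd ℂ (z (n + j))) N‖ ≤ (if i = j then 1 else 0) +
        (if i = j then 0 else ‖cesaro (fun n => z (n + i) * starRingEnd ℂ (z (n + j))) N‖) := by
      intro i _ j _
      split_ifs with hij
      · simpa using norm_cesaro_le zero_le_one (fun n => hb _ _) N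
      · simp
    have h4 := norm_sum_le_of_le (range H) fun i hi => norm_sum_le_of_le (range H) (this i hi)
    simp only [sum_add_distrib] at h4
    have h5 : ∑ i ∈ range H, ∑ j ∈ range H, (if i = j then (1 : ℝ) else 0) = H := by
      rw [sum_congr rfl fun i hi => by rw [sum_ite_eq, if_pos hi]]
      simp
    linarith
  have h6 := (norm_cesaro_sq_le S N).trans h3
  have h7 : H * ‖cesaro z N‖ ≤ ‖cesaro S N‖ + 1 := by
    have h8 : ‖(H : ℂ) * cesaro z N‖ ≤ ‖cesaro S N‖ + ‖cesaro S N - H * cesaro z N‖ := by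
      have := norm_sub_le (cesaro S N) (cesaro S N - H * cesaro z N)
      rwa [sub_sub_cancel] at this
    rw [norm_mul, Complex.norm_natCast] at h8
    linarith
  by_contra! hcon
  rw [div_lt_iff₀ (by positivity)] at hH2
  have h9 : H * ε ≤ ‖cesaro S N‖ + 1 := le_trans (by gcongr) h7
  have h10 : (H * ε) ^ 2 ≤ (‖cesaro S N‖ + 1) ^ 2 := by gcongr
  nlinarith [sq_nonneg (‖cesaro S N‖ - 1), mul_lt_mul_of_pos_left hH2 (show (0 : ℝ) < H by linarith)]


theorem tendsto_cesaro_periodic {f : ℕ → ℂ} {M : ℕ} (hM : 0 < M) (hf : Function.Periodic f M) :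
    Tendsto (cesaro f) atTop (nhds ((M : ℂ)⁻¹ * ∑ j ∈ Icc 1 M, f j)) := by
  set V := (M : ℂ)⁻¹ * ∑ j ∈ Icc 1 M, f j with hV
  have hM' : (M : ℂ) ≠ 0 := by exact_mod_cast hM.ne'
  have hsum : ∑ j ∈ Icc 1 M, f j = ∑ j ∈ range M, f j := by
    rw [range_eq_Ico, ← Ico_add_one_right_eq_Icc, sum_Ico_eq_sum_range, ← range_eq_Ico]
    have h1 := sum_range_succ f M
    have h2 := sum_range_succ' f M
    have h3 : f M = f 0 := by simpa using hf 0
    rw [h3] at h1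
    simp only [add_tsub_cancel_right, add_comm 1]
    exact add_right_cancel (h2.symm.trans h1)
  have hz : ∑ j ∈ range M, (f j - V) = 0 := by
    rw [sum_sub_distrib, sum_const, card_range, nsmul_eq_mul, hV, mul_inv_cancel_left₀ hM', hsum,
      sub_self]
  have hper : Function.Periodic (fun N => ∑ n ∈ range N, (f n - V)) M := by
    intro N
    simp only
    rw [add_comm, sum_range_add, hz, zero_add]
    exact sum_congr rfl fun n _ => by rw [add_comm, hf n]
  obtain ⟨B, hB⟩ := ((range M).image fun N => ‖∑ n ∈ range N, (f n - V)‖).bddAbove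
  have h0 : Tendsto (cesaro fun n => f n - V) atTop (nhds 0) := by
    refine tendsto_cesaro_zero_of_bounded (B := B) fun N => ?_
    rw [← hper.map_mod_nat N]
    exact hB (mem_coe.2 (mem_image_of_mem _ (mem_range.2 (Nat.mod_lt _ hM))))
  have h1 : Tendsto (fun N => cesaro (fun n => f n - V) N + V) atTop (nhds V) := by
    simpa using h0.add_const V
  refine h1.congr' ?_
  filter_upwards [eventually_gt_atTop 0] with N hN
  have hN' : (N : ℂ) ≠ 0 := by exact_mod_cast hN.ne'
  rw [cesaro_sub]
  simp [cesaro, hN']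

theorem natDegree_taylor_sub_self (P : Polynomial ℤ) {d : ℕ} (hP : P.natDegree = d + 1) {h : ℤ}
    (hh : h ≠ 0) : (P.taylor h - P).natDegree = d := by
  have hd : (P.taylor h - P).coeff d ≠ 0 := by
    have h1 : (P.taylor h).coeff d = P.coeff d + (d + 1) * P.coeff (d + 1) * h := by
      have h2 : (Polynomial.hasseDeriv d P).natDegree < 2 := by
        have := Polynomial.natDegree_hasseDeriv_le P d
        omega
      rw [Polynomial.taylor_coeff, Polynomial.eval_eq_sum_range' h2]
      simp [sum_range_succ, Polynomial.hasseDeriv_coeff, add_comm 1 d]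
    have h3 : P.coeff (d + 1) ≠ 0 := by
      rw [← hP, Polynomial.coeff_natDegree, Polynomial.leadingCoeff_ne_zero]
      rintro rfl
      simp at hP
    rw [Polynomial.coeff_sub, h1, add_sub_cancel_left]
    have h4 : ((d : ℤ) + 1) ≠ 0 := by positivity
    positivity
  refine le_antisymm (Polynomial.natDegree_le_iff_coeff_eq_zero.2 fun n hn => ?_)
    (Polynomial.le_natDegree_of_ne_zero hd)
  rcases (Nat.succ_le_of_lt hn).eq_or_lt with rfl | hn'
  · have h1 : (P.taylor h).coeff (d + 1) = P.coeff (d + 1) := by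
      rw [← hP, Polynomial.coeff_taylor_natDegree, Polynomial.coeff_natDegree]
    rw [Polynomial.coeff_sub, h1, sub_self]
  · rw [Polynomial.coeff_sub, Polynomial.coeff_eq_zero_of_natDegree_lt,
      Polynomial.coeff_eq_zero_of_natDegree_lt, sub_self]
    · omega
    · rw [Polynomial.natDegree_taylor]
      omega

/-- Weyl's theorem on exponential sums, with periodic weights. -/
theorem tendsto_cesaro_weyl {θ : ℝ} (hθ : Irrational θ) {M : ℕ} (hM : 0 < M) (d : ℕ) :
    ∀ (P : Polynomial ℤ), P.natDegree = d + 1 → ∀ f : ℕ → ℂ, Function.Periodic f M →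
      (∀ n, ‖f n‖ ≤ 1) →
      Tendsto (cesaro fun n => f n * e (θ * ((P.eval (n : ℤ) : ℤ) : ℝ))) atTop (nhds 0) := by
  induction d with
  | zero =>
    intro P hP f hf hf1
    obtain ⟨a, ha, b, rfl⟩ := Polynomial.natDegree_eq_one.1 hP
    set z : ℕ → ℂ := fun n =>
      f n * e (θ * (((Polynomial.C a * Polynomial.X + Polynomial.C b).eval (n : ℤ) : ℤ) : ℝ))
      with hz
    have hw : e (θ * ((a * M : ℤ) : ℝ)) - 1 ≠ 0 := by
      rw [sub_ne_zero, Ne, e_eq_one_iff]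
      rintro ⟨m, hm⟩
      have haM : a * M ≠ 0 := mul_ne_zero ha (by exact_mod_cast hM.ne')
      exact (hθ.mul_intCast haM).ne_int m hm.symm
    have hshift : ∀ n, z (n + M) = e (θ * ((a * M : ℤ) : ℝ)) * z n := by
      intro n
      simp only [hz, hf n]
      rw [mul_left_comm, ← e_add]
      congr 2
      simp
      ring
    have h1 := tendsto_cesaro_shift_sub (z := z) (B := 1)
      (fun n => by simpa [hz, norm_e] using hf1 n) M
    simp only [hshift, cesaro_const_mul] at h1
    have h2 := h1.const_mul (e (θ * ((a * M : ℤ) : ℝ)) - 1)⁻¹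
    rw [mul_zero] at h2
    refine h2.congr fun N => ?_
    field_simp
  | succ d ih =>
    intro P hP f hf hf1
    refine tendsto_cesaro_zero_of_correlations (fun n => by simpa [norm_e] using hf1 n)
      fun h hh => ?_
    have hh' : (h : ℤ) ≠ 0 := by exact_mod_cast hh.ne'
    refine (ih (P.taylor (h : ℤ) - P) (natDegree_taylor_sub_self P hP hh')
      (fun n => f (n + h) * starRingEnd ℂ (f n)) (fun n => ?_) (fun n => ?_)).congr fun N => ?_
    · simp only [hf n, add_right_comm n M h, hf (n + h)]
    · rw [norm_mul, RCLike.norm_conj]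
      exact mul_le_one₀ (hf1 _) (norm_nonneg _) (hf1 _)
    · congr 1
      ext n
      rw [map_mul, conj_e, mul_mul_mul_comm, ← e_add]
      congr 2
      simp [Polynomial.taylor_eval]
      ring

theorem tendsto_cesaro_continuous {v : ℕ → ℂ} (hv : ∀ n, ‖v n‖ ≤ 1) {x : ℕ → ℝ} {V : ℂ}
    (hV : Tendsto (cesaro v) atTop (nhds V))
    (hk : ∀ k : ℤ, k ≠ 0 → Tendsto (cesaro fun n => v n * e (k * x n)) atTop (nhds 0))
    (g : C(AddCircle (1 : ℝ), ℂ)) :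
    Tendsto (cesaro fun n => v n * g (x n : AddCircle (1 : ℝ))) atTop
      (nhds (V * ∫ y, g y ∂AddCircle.haarAddCircle)) := by
  have hfour : ∀ (k : ℤ) (y : ℝ), fourier k (y : AddCircle (1 : ℝ)) = e (k * y) := by
    intro k y
    rw [fourier_coe_apply, e]
    congr 1
    push_cast
    ring
  have hgi : ∀ g : C(AddCircle (1 : ℝ), ℂ),
      MeasureTheory.Integrable g AddCircle.haarAddCircle := fun g =>
    g.continuous.integrable_of_hasCompactSupport (HasCompactSupport.of_compactSpace _)
  have htrig : ∀ T ∈ Submodule.span ℂ (Set.range (fourier (T := (1 : ℝ)))),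
      Tendsto (cesaro fun n => v n * T (x n : AddCircle (1 : ℝ))) atTop
        (nhds (V * ∫ y, T y ∂AddCircle.haarAddCircle)) := by
    intro T hT
    induction hT using Submodule.span_induction with
    | mem T hT =>
      obtain ⟨k, rfl⟩ := hT
      rcases eq_or_ne k 0 with rfl | hk0
      · simpa using hV
      · have h0 : ∫ y : AddCircle (1 : ℝ), fourier k y ∂AddCircle.haarAddCircle = 0 :=
          MeasureTheory.integral_eq_zero_of_add_right_eq_neg
            (fourier_add_half_inv_index hk0 zero_lt_one)
        rw [h0, mul_zero]
        simpa only [hfour] using hk k hk0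
    | zero => simpa using tendsto_cesaro_zero_of_bounded (z := fun _ => 0) (B := 0) (by simp)
    | add S T _ _ hS hT =>
      simp only [ContinuousMap.add_apply, mul_add, MeasureTheory.integral_add (hgi S) (hgi T)]
      refine (hS.add hT).congr fun N => (cesaro_add _ _ _).symm
    | smul b T _ hT =>
      simp only [ContinuousMap.smul_apply, smul_eq_mul, MeasureTheory.integral_const_mul]
      simp only [mul_left_comm _ b]
      exact (hT.const_mul b).congr fun N => (cesaro_const_mul _ _ _).symm
  have hVn : ‖V‖ ≤ 1 :=
    le_of_tendsto hV.norm (Eventually.of_forall fun N => norm_cesaro_le zero_le_one hv N)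
  rw [Metric.tendsto_nhds]
  intro ε hε
  have hg : g ∈ (Submodule.span ℂ (Set.range (fourier (T := (1 : ℝ))))).topologicalClosure := by
    rw [span_fourier_closure_eq_top]
    trivial
  obtain ⟨T, hT, hgT⟩ := Metric.mem_closure_iff.1 hg (ε / 3) (by positivity)
  have hpt : ∀ y, ‖g y - T y‖ ≤ ε / 3 := fun y => by
    rw [← dist_eq_norm]
    exact (ContinuousMap.dist_apply_le_dist y).trans hgT.le
  filter_upwards [Metric.tendsto_nhds.1 (htrig T hT) (ε / 3) (by positivity)] with N hN
  rw [dist_eq_norm] at hN ⊢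
  have h1 : ‖cesaro (fun n => v n * (g (x n) - T (x n))) N‖ ≤ ε / 3 :=
    norm_cesaro_le (by positivity) (fun n => by
      rw [norm_mul]
      calc _ ≤ 1 * (ε / 3) := mul_le_mul (hv n) (hpt _) (norm_nonneg _) zero_le_one
        _ = _ := one_mul _) N
  have h2 : ‖V * ∫ y, (T y - g y) ∂AddCircle.haarAddCircle‖ ≤ ε / 3 := by
    rw [norm_mul]
    calc _ ≤ 1 * (ε / 3) := by
          refine mul_le_mul hVn ?_ (norm_nonneg _) zero_le_one
          refine (MeasureTheory.norm_integral_le_of_norm_le_const (C := ε / 3)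
            (Eventually.of_forall fun y => ?_)).trans (by simp)
          rw [norm_sub_rev]
          exact hpt y
      _ = _ := one_mul _
  simp only [mul_sub, cesaro_sub] at h1
  rw [MeasureTheory.integral_sub (hgi T) (hgi g), mul_sub] at h2
  have h3 := norm_add₃_le (a := cesaro (fun n => v n * g (x n)) N - cesaro (fun n => v n * T (x n)) N)
    (b := cesaro (fun n => v n * T (x n)) N - V * ∫ y, T y ∂AddCircle.haarAddCircle)
    (c := V * ∫ y, T y ∂AddCircle.haarAddCircle - V * ∫ y, g y ∂AddCircle.haarAddCircle)
  rw [sub_add_sub_cancel, sub_add_sub_cancel] at h3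
  linarith

theorem tendsto_cesaro_fract_of_continuousOn {v : ℕ → ℂ} (hv : ∀ n, ‖v n‖ ≤ 1) {x : ℕ → ℝ} {V : ℂ}
    (hV : Tendsto (cesaro v) atTop (nhds V))
    (hk : ∀ k : ℤ, k ≠ 0 → Tendsto (cesaro fun n => v n * e (k * x n)) atTop (nhds 0))
    {g : ℝ → ℂ} (hg : ContinuousOn g (Set.Icc 0 1)) (h01 : g 0 = g 1) :
    Tendsto (cesaro fun n => v n * g (Int.fract (x n))) atTop
      (nhds (V * ∫ y in (0 : ℝ)..1, g y)) := by
  have hcoe : ∀ y : ℝ, AddCircle.liftIco 1 0 g (y : AddCircle (1 : ℝ)) = g (Int.fract y) := by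
    intro y
    have h1 : (y : AddCircle (1 : ℝ)) = (Int.fract y : ℝ) := by
      rw [← sub_eq_zero, ← AddCircle.coe_sub, AddCircle.coe_eq_zero_iff]
      exact ⟨⌊y⌋, by rw [zsmul_one, Int.self_sub_fract]⟩
    rw [h1, AddCircle.liftIco_zero_coe_apply ⟨Int.fract_nonneg y, Int.fract_lt_one y⟩]
  have h := tendsto_cesaro_continuous hv hV hk
    ⟨AddCircle.liftIco 1 0 g, AddCircle.liftIco_zero_continuous h01 hg⟩
  have hgi : ∫ y, AddCircle.liftIco 1 0 g y ∂AddCircle.haarAddCircle = ∫ y in (0 : ℝ)..1, g y := by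
    have h2 := fourierCoeff_liftIco_eq (T := 1) (a := 0) g 0
    rw [fourierCoeffOn_eq_integral] at h2
    simpa [fourierCoeff] using h2
  simpa only [ContinuousMap.coe_mk, hcoe, hgi] using h

theorem integral_one_sub_two_mul_pow (k : ℕ) :
    ∫ y in (0 : ℝ)..1, (1 - 2 * y) ^ (2 * k) = 1 / (2 * k + 1) := by
  rw [intervalIntegral.integral_comp_sub_mul (fun y => y ^ (2 * k)) two_ne_zero, integral_pow]
  norm_num [pow_succ, pow_mul]
  field_simp

theorem tendsto_cesaro_e_fract {v : ℕ → ℂ} (hv : ∀ n, ‖v n‖ ≤ 1) {x : ℕ → ℝ} {V : ℂ}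
    (hV : Tendsto (cesaro v) atTop (nhds V))
    (hk : ∀ k : ℤ, k ≠ 0 → Tendsto (cesaro fun n => v n * e (k * x n)) atTop (nhds 0))
    (hx : ∀ k : ℤ, k ≠ 0 → Tendsto (cesaro fun n => e (k * x n)) atTop (nhds 0)) (σ : ℝ) :
    Tendsto (cesaro fun n => v n * e (σ * Int.fract (x n))) atTop
      (nhds (V * ∫ y in (0 : ℝ)..1, e (σ * y))) := by
  have hVn : ‖V‖ ≤ 1 :=
    le_of_tendsto hV.norm (Eventually.of_forall fun N => norm_cesaro_le zero_le_one hv N)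
  rw [Metric.tendsto_nhds]
  intro ε hε
  obtain ⟨k, hk4⟩ := exists_nat_gt (max 1 (4 / ε))
  have hk1 : (1 : ℝ) < k := (le_max_left _ _).trans_lt hk4
  have hk2 : 4 / ε < k := (le_max_right _ _).trans_lt hk4
  set H : ℝ → ℝ := fun y => (1 - 2 * y) ^ (2 * k) with hH
  have hH0 : ∀ y, 0 ≤ H y := fun y => by
    simp only [hH, pow_mul]
    positivity
  have hHc : Continuous H := by fun_prop
  have hk0 : k ≠ 0 := by
    rintro rfl
    norm_num at hk1
  have hH1 : H 0 = 1 ∧ H 1 = 1 := by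
    constructor
    · simp [hH]
    · norm_num [hH, pow_mul]
  have hI : ∫ y in (0 : ℝ)..1, H y < ε / 4 := by
    rw [integral_one_sub_two_mul_pow, div_lt_iff₀ (by positivity)]
    rw [div_lt_iff₀ hε] at hk2
    nlinarith
  have hec : Continuous fun y => e (σ * y) := continuous_e.comp (continuous_const_mul σ)
  have hHc' : Continuous fun y => (H y : ℂ) := Complex.continuous_ofReal.comp hHc
  set G : ℝ → ℂ := fun y => e (σ * y) * (1 - H y) with hG
  have hGc : Continuous G := hec.mul (continuous_const.sub hHc')
  have hlimG := tendsto_cesaro_fract_of_continuousOn hv hV hk hGc.continuousOn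
    (by simp [hG, hH1])
  have hone : Tendsto (cesaro fun _ => 1) atTop (nhds 1) := by
    refine tendsto_const_nhds.congr' ?_
    filter_upwards [eventually_gt_atTop 0] with N hN
    have hN' : (N : ℂ) ≠ 0 := by exact_mod_cast hN.ne'
    simp [cesaro, hN']
  have hlimH := tendsto_cesaro_fract_of_continuousOn (v := fun _ => 1) (x := x) (by simp) hone
    (by simpa using hx) hHc'.continuousOn (by simp [hH1])
  simp only [one_mul] at hlimH
  have hlimH' := (Complex.continuous_re.tendsto _).comp hlimH
  rw [intervalIntegral.integral_ofReal, Complex.ofReal_re] at hlimH'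
  filter_upwards [Metric.tendsto_nhds.1 hlimG (ε / 4) (by positivity),
    hlimH'.eventually (gt_mem_nhds hI)] with N hN1 hN2
  rw [dist_eq_norm] at hN1 ⊢
  have hFG : ∀ y, ‖e (σ * y) - G y‖ = H y := fun y => by
    have : e (σ * y) - G y = e (σ * y) * H y := by
      simp only [hG]
      ring
    rw [this, norm_mul, norm_e, one_mul, Complex.norm_real, Real.norm_of_nonneg (hH0 y)]
  have h1 : ‖cesaro (fun n => v n * (e (σ * Int.fract (x n)) - G (Int.fract (x n)))) N‖ ≤ ε / 4 := by
    refine (norm_cesaro_le_re (w := fun n => H (Int.fract (x n))) (fun n => ?_) N).trans hN2.le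
    rw [norm_mul, hFG]
    exact mul_le_of_le_one_left (hH0 _) (hv n)
  have h2 : ‖V * ∫ y in (0 : ℝ)..1, (e (σ * y) - G y)‖ ≤ ε / 4 := by
    rw [norm_mul]
    refine (mul_le_of_le_one_left (norm_nonneg _) hVn).trans ?_
    refine (intervalIntegral.norm_integral_le_integral_norm zero_le_one).trans ?_
    simp only [hFG]
    exact hI.le
  simp only [mul_sub, cesaro_sub] at h1
  rw [intervalIntegral.integral_sub (hec.intervalIntegrable _ _) (hGc.intervalIntegrable _ _),
    mul_sub, norm_sub_rev] at h2
  have h3 := norm_add₃_le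
    (a := cesaro (fun n => v n * e (σ * Int.fract (x n))) N -
      cesaro (fun n => v n * G (Int.fract (x n))) N)
    (b := cesaro (fun n => v n * G (Int.fract (x n))) N - V * ∫ y in (0 : ℝ)..1, G y)
    (c := (V * ∫ y in (0 : ℝ)..1, G y) - V * ∫ y in (0 : ℝ)..1, e (σ * y))
  rw [sub_add_sub_cancel, sub_add_sub_cancel] at h3
  linarith

theorem integral_e_mul (σ : ℝ) : ∫ y in (0 : ℝ)..1, e (σ * y) =
    if σ = 0 then 1 else (e σ - 1) / (2 * (Real.pi : ℂ) * Complex.I * (σ : ℂ)) := by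
  split_ifs with h
  · simp [h, e_zero]
  · have hc : 2 * (Real.pi : ℂ) * Complex.I * (σ : ℂ) ≠ 0 :=
      mul_ne_zero Complex.two_pi_I_ne_zero (by exact_mod_cast h)
    have := integral_exp_mul_complex (a := 0) (b := 1) hc
    simpa [e, mul_assoc] using this

theorem IfacR_intCast (R : ℤ) (s : ℝ) : IfacR R s = ∫ y in (0 : ℝ)..1, e ((R + s) * y) := by
  rw [integral_e_mul, IfacR, if_neg (not_not.2 ⟨R, rfl⟩)]
  simp only [← eq_neg_iff_add_eq_zero (a := (R : ℝ))]
  split_ifs with h1 h2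
  · rfl
  · obtain ⟨m, -, hm⟩ := h2
    rw [← hm, e_intCast, sub_self, zero_div]
  · rfl

theorem IfacR_eq_zero_iff (r s : ℝ) :
    IfacR r s = 0 ↔ (¬ ∃ m : ℤ, (m : ℝ) = r) ∨ ∃ m : ℤ, m ≠ 0 ∧ (m : ℝ) = r + s := by
  by_cases h1 : ∃ m : ℤ, (m : ℝ) = r
  swap
  · simp [IfacR, h1]
  rw [IfacR, if_neg (not_not.2 h1)]
  simp only [h1, not_true_eq_false, false_or]
  split_ifs with h2 h3
  · simp only [one_ne_zero, false_iff, h2, neg_add_cancel]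
    rintro ⟨m, hm, hm'⟩
    exact hm (by exact_mod_cast hm')
  · simp [h3]
  · simp only [h3, iff_false]
    have h4 : r + s ≠ 0 := fun h => h2 (eq_neg_of_add_eq_zero_left h)
    refine div_ne_zero ?_ (mul_ne_zero Complex.two_pi_I_ne_zero (Complex.ofReal_ne_zero.2 h4))
    rw [sub_ne_zero, Ne, e_eq_one_iff]
    rintro ⟨m, hm⟩
    refine h3 ⟨m, ?_, hm⟩
    rintro rfl
    exact h4 (by simpa using hm.symm)

theorem periodic_e_fract {c : ℕ} (hc : 1 ≤ c) {l : ℤ} (hl : l ≠ 0) {q : ℝ}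
    (hq : ∃ m : ℤ, q = (m : ℝ) / (c : ℝ)) (P : Polynomial ℤ) (ρ t : ℝ) {p : ℕ → ℝ}
    (hp : ∀ n, p n = ((P.eval (n : ℤ) : ℤ) : ℝ) + ρ) :
    Function.Periodic (fun n => e (q * p n / (l : ℝ) - Int.fract (p n / (l : ℝ)) * t))
      ((c : ℤ) * l).natAbs := by
  obtain ⟨m, rfl⟩ := hq
  intro n
  have hc' : (c : ℝ) ≠ 0 := by positivity
  have hl' : (l : ℝ) ≠ 0 := by exact_mod_cast hl
  obtain ⟨k, hk⟩ : (c : ℤ) * l ∣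
      P.eval ((n + ((c : ℤ) * l).natAbs : ℕ) : ℤ) - P.eval (n : ℤ) := by
    refine dvd_trans ?_ (Polynomial.sub_dvd_eval_sub _ _ P)
    rw [Nat.cast_add, add_sub_cancel_left]
    exact Int.dvd_natAbs.2 dvd_rfl
  have h1 : p (n + ((c : ℤ) * l).natAbs) = p n + c * l * k := by
    have h2 : ((P.eval ((n + ((c : ℤ) * l).natAbs : ℕ) : ℤ) : ℤ) : ℝ) =
        P.eval (n : ℤ) + c * l * k := by
      exact_mod_cast eq_add_of_sub_eq' hk
    rw [hp, hp, h2]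
    ring
  have h3 : p (n + ((c : ℤ) * l).natAbs) / l = p n / l + ((c * k : ℤ) : ℝ) := by
    rw [h1]
    push_cast
    field_simp
  have h4 : (m : ℝ) / c * p (n + ((c : ℤ) * l).natAbs) / l =
      (m : ℝ) / c * p n / l + ((m * k : ℤ) : ℝ) := by
    rw [h1]
    push_cast
    field_simp
  simp only [h3, h4, Int.fract_add_intCast]
  rw [add_sub_right_comm, e_add, e_intCast, mul_one]

theorem tendsto_cesaro_weyl_affine {β : ℝ} (hβ : Irrational β) (u : ℝ) {c : ℕ} (hc : 1 ≤ c)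
    {l : ℤ} (hl : l ≠ 0) {P : Polynomial ℤ} (hP : 0 < P.natDegree) (ρ : ℝ) {M : ℕ} (hM : 0 < M)
    {f : ℕ → ℂ} (hf : Function.Periodic f M) (hf1 : ∀ n, ‖f n‖ ≤ 1) {κ : ℝ}
    (hκ : ∃ m : ℤ, κ = (m : ℝ) / (c : ℝ)) (hκ0 : κ ≠ 0) :
    Tendsto (cesaro fun n =>
      f n * e (κ * (β * ((((P.eval (n : ℤ) : ℤ) : ℝ) + ρ) / l) + u))) atTop (nhds 0) := by
  obtain ⟨m, rfl⟩ := hκ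
  have hm : m ≠ 0 := by
    rintro rfl
    simp at hκ0
  have hcl : (c : ℤ) * l ≠ 0 := mul_ne_zero (by exact_mod_cast (by omega : c ≠ 0)) hl
  have hθ : Irrational (β * m / ((c * l : ℤ) : ℝ)) := (hβ.mul_intCast hm).div_intCast hcl
  have h := (tendsto_cesaro_weyl hθ hM (P.natDegree - 1) P (by omega) f hf hf1).const_mul
    (e (m / c * (β * (ρ / l) + u)))
  rw [mul_zero] at h
  refine h.congr fun N => ?_
  rw [← cesaro_const_mul]
  congr 1
  ext n
  rw [mul_left_comm, ← e_add]
  congr 2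
  have hc' : (c : ℝ) ≠ 0 := by positivity
  have hl' : (l : ℝ) ≠ 0 := by exact_mod_cast hl
  push_cast
  field_simp
  ring

/-- Let `β` be irrational, `c ≥ 1`, `l ∈ ℤ∖{0}`, `q, r ∈ (1/c)·ℤ`,
`p(x) = P(x) + ρ` with `P ∈ ℤ[x]` nonconstant, and `a(n) = p(n)/l`. Then the averages
`(1/N)·Σ e(q·a(n) + βr·a(n) − {a(n)}t + {βa(n)+u}s)` converge to `e(−ru)·S·J_r` where
`S = (1/|cl|)·Σ_{j=1}^{|cl|} e(q·p(j)/l − {p(j)/l}·t)`, and the limit is `0` iff `S = 0`,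
or `r ∉ ℤ`, or `r + s ∈ ℤ∖{0}`. -/
theorem stmt9 (β : ℝ) (hβ : Irrational β) (u t s : ℝ) (c : ℕ) (hc : 1 ≤ c)
    (l : ℤ) (hl : l ≠ 0) (q r : ℝ)
    (hq : ∃ m : ℤ, q = (m : ℝ) / (c : ℝ)) (hr : ∃ m : ℤ, r = (m : ℝ) / (c : ℝ))
    (P : Polynomial ℤ) (hP : 0 < P.natDegree) (ρ : ℝ)
    (p : ℕ → ℝ) (hp : ∀ n, p n = ((P.eval (n : ℤ) : ℤ) : ℝ) + ρ)
    (a : ℕ → ℝ) (ha : ∀ n, a n = p n / (l : ℝ)) :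
    Tendsto (fun N : ℕ => (N : ℂ)⁻¹ * ∑ n ∈ Finset.Icc 1 N,
        e (q * a n + β * r * a n - Int.fract (a n) * t + Int.fract (β * a n + u) * s))
      atTop
      (nhds (e (-(r * u)) *
        ((((((c : ℤ) * l).natAbs : ℕ) : ℂ))⁻¹ * ∑ j ∈ Finset.Icc 1 ((c : ℤ) * l).natAbs,
          e (q * p j / (l : ℝ) - Int.fract (p j / (l : ℝ)) * t)) * IfacR r s)) ∧
    (e (-(r * u)) *
        ((((((c : ℤ) * l).natAbs : ℕ) : ℂ))⁻¹ * ∑ j ∈ Finset.Icc 1 ((c : ℤ) * l).natAbs,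
          e (q * p j / (l : ℝ) - Int.fract (p j / (l : ℝ)) * t)) * IfacR r s = 0 ↔
      ((((((c : ℤ) * l).natAbs : ℕ) : ℂ))⁻¹ * ∑ j ∈ Finset.Icc 1 ((c : ℤ) * l).natAbs,
          e (q * p j / (l : ℝ) - Int.fract (p j / (l : ℝ)) * t)) = 0 ∨
        (¬ ∃ m : ℤ, (m : ℝ) = r) ∨ ∃ m : ℤ, m ≠ 0 ∧ (m : ℝ) = r + s) := by
  have hcl : 0 < ((c : ℤ) * l).natAbs :=
    Int.natAbs_pos.2 (mul_ne_zero (by exact_mod_cast (by omega : c ≠ 0)) hl)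
  set M := ((c : ℤ) * l).natAbs
  set f : ℕ → ℂ := fun n => e (q * p n / (l : ℝ) - Int.fract (p n / (l : ℝ)) * t) with hf
  set V : ℂ := (M : ℂ)⁻¹ * ∑ j ∈ Icc 1 M, f j with hV
  have hfper : Function.Periodic f M := periodic_e_fract hc hl hq P ρ t hp
  have hf1 : ∀ n, ‖f n‖ ≤ 1 := fun n => (norm_e _).le
  constructor
  · set x : ℕ → ℝ := fun n => β * ((((P.eval (n : ℤ) : ℤ) : ℝ) + ρ) / l) + u with hx
    have hweyl : ∀ {g : ℕ → ℂ} {κ : ℝ}, Function.Periodic g M → (∀ n, ‖g n‖ ≤ 1) →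
        (∃ m : ℤ, κ = (m : ℝ) / (c : ℝ)) → κ ≠ 0 →
        Tendsto (cesaro fun n => g n * e (κ * x n)) atTop (nhds 0) :=
      fun hg hg1 hκ hκ0 => tendsto_cesaro_weyl_affine hβ u hc hl hP ρ hcl hg hg1 hκ hκ0
    have hc' : (c : ℝ) ≠ 0 := by positivity
    have hgi : ∀ k : ℤ, ∃ m : ℤ, (k : ℝ) = (m : ℝ) / (c : ℝ) := fun k =>
      ⟨k * c, by push_cast; field_simp⟩
    have hx0 : ∀ k : ℤ, k ≠ 0 → Tendsto (cesaro fun n => e (k * x n)) atTop (nhds 0) := by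
      intro k hk
      simpa using hweyl (g := fun _ => 1) (fun _ => rfl) (by simp) (hgi k) (by exact_mod_cast hk)
    have hmain : Tendsto (cesaro fun n => f n * e (r * x n) * e (s * Int.fract (x n))) atTop
        (nhds (V * IfacR r s)) := by
      by_cases hri : ∃ R : ℤ, (R : ℝ) = r
      · obtain ⟨R, rfl⟩ := hri
        rw [IfacR_intCast]
        refine (tendsto_cesaro_e_fract hf1 (tendsto_cesaro_periodic hcl hfper) (fun k hk =>
          hweyl hfper hf1 (hgi k) (by exact_mod_cast hk)) hx0 (R + s)).congr fun N => ?_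
        congr 1
        ext n
        rw [add_mul, e_add, e_int_mul_fract, mul_assoc]
      · have hr0 : ∀ k : ℤ, (k : ℝ) + r ≠ 0 := fun k hk =>
          hri ⟨-k, by push_cast; linarith⟩
        have h0 : IfacR r s = 0 := (IfacR_eq_zero_iff r s).2 (Or.inl hri)
        have h := tendsto_cesaro_e_fract (v := fun n => f n * e (r * x n)) (x := x) (V := 0)
          (fun n => by simpa [norm_e] using hf1 n)
          (hweyl hfper hf1 hr (by simpa using hr0 0)) (fun k hk => ?_) hx0 s
        · rw [h0, mul_zero]
          simpa using h
        · obtain ⟨m, hm⟩ := hr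
          obtain ⟨m', hm'⟩ := hgi k
          refine (hweyl hfper hf1 (κ := k + r) ⟨m' + m, ?_⟩ (hr0 k)).congr fun N => ?_
          · rw [hm', hm]
            push_cast
            ring
          · congr 1
            ext n
            rw [add_comm, add_mul, e_add, mul_assoc]
    have hshift := tendsto_cesaro_shift (z := fun n => e (-(r * u)) *
      (f n * e (r * x n) * e (s * Int.fract (x n)))) (B := 1)
      (fun n => by simpa [norm_e] using hf1 n) (V := e (-(r * u)) * (V * IfacR r s))
      ((hmain.const_mul _).congr fun N => (cesaro_const_mul _ _ _).symm) 1
    rw [← mul_assoc] at hshift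
    refine hshift.congr fun N => ?_
    rw [cesaro, ← Ico_add_one_right_eq_Icc, sum_Ico_eq_sum_range]
    simp only [add_tsub_cancel_right]
    congr 1
    refine sum_congr rfl fun n _ => ?_
    have hax : x (n + 1) = β * a (n + 1) + u := by rw [ha, hp]
    simp only [hax, hf, ← e_add, ha, add_comm 1 n]
    congr 1
    ring
  · rw [mul_eq_zero, mul_eq_zero, IfacR_eq_zero_iff]
    have : e (-(r * u)) ≠ 0 := fun h => by simpa [h] using norm_e (-(r * u))
    simp only [this, false_or]

end
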